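/- Let F be a field of any characteristic in which −1 is a square. If ψ₁ and ψ₂ are quadratic Pfister forms over F that are (k+1)-linked, then their k-invariant F_k(ψ₁, ψ₂) is hyperbolic. -/

import Mathlib

noncomputable section

open QuadraticMap

/-- A quadratic form over `F` on the space `F^d`, bundled together with its dimension `d`. -/
structure QF (F : Type) [Field F] where
  dim : ℕ
  form : QuadraticForm F (Fin dim → F)

namespace QF

variable {F : Type} [Field F]

/-- Isometry of bundled quadratic forms. -/
def Equiv (q q' : QF F) : Prop := QuadraticMap.Equivalent q.form q'.form

/-- The standard linear equivalence `F^(a+b) ≃ F^a × F^b`. -/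
def finSplit (F : Type) [Field F] (a b : ℕ) :
    (Fin (a + b) → F) ≃ₗ[F] (Fin a → F) × (Fin b → F) :=
  (LinearEquiv.funCongrLeft F F finSumFinEquiv).trans
    (LinearEquiv.sumArrowLequivProdArrow _ _ F F)

/-- Orthogonal sum of bundled quadratic forms. -/
def sum (q₁ q₂ : QF F) : QF F :=
  ⟨q₁.dim + q₂.dim, (q₁.form.prod q₂.form).comp (finSplit F q₁.dim q₂.dim).toLinearMap⟩

instance : Neg (QF F) := ⟨fun q => ⟨q.dim, -q.form⟩⟩

instance : SMul F (QF F) := ⟨fun a q => ⟨q.dim, a • q.form⟩⟩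

/-- `⟨⟨γ⟩⟩ ⊗ q = q ⊥ (−γ)·q` : twisting a quadratic form by the
1-fold bilinear Pfister form `⟨⟨γ⟩⟩ = ⟨1, −γ⟩`. -/
def twist (γ : F) (q : QF F) : QF F := q.sum ((-γ) • q)

/-- `⟨⟨γ₁,…,γ_m⟩⟩ ⊗ q` : tensoring a quadratic form with the `m`-fold bilinear
Pfister form whose slots are the entries of the list `l = [γ₁,…,γ_m]`. -/
def btensor (l : List F) (q : QF F) : QF F := l.foldr twist q

/-- The zero form on the zero space. -/
def zero (F : Type) [Field F] : QF F := ⟨0, 0⟩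

/-- The one-dimensional form `⟨1⟩`, `x ↦ x²`. -/
def unit (F : Type) [Field F] : QF F := ⟨1, QuadraticMap.sq.comp (LinearMap.proj 0)⟩

/-- The binary quadratic form `[1,α] : (x,y) ↦ x² + xy + αy²`. -/
def binary (α : F) : QF F := ⟨2, (Matrix.of ![![1, 1], ![0, α]]).toQuadraticMap'⟩

/-- The hyperbolic plane `ℍ : (x,y) ↦ xy`. -/
def hyp (F : Type) [Field F] : QF F := ⟨2, (Matrix.of ![![0, 1], ![0, 0]]).toQuadraticMap'⟩

/-- `m × ℍ`, the orthogonal sum of `m` hyperbolic planes. -/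
def hyps (F : Type) [Field F] : ℕ → QF F
  | 0 => zero F
  | n + 1 => (hyp F).sum (hyps F n)

/-- A quadratic form is isotropic if it represents `0` nontrivially. -/
def Isotropic (q : QF F) : Prop := ∃ v, q.form v = 0 ∧ v ≠ 0

/-- A quadratic form is hyperbolic if it is isometric to an orthogonal
sum of hyperbolic planes. -/
def Hyperbolic (q : QF F) : Prop := ∃ m, q.Equiv (hyps F m)

/-- All entries of the list are nonzero (the slots of a bilinear Pfister form
must be units). -/
def UnitList (l : List F) : Prop := ∀ γ ∈ l, γ ≠ 0

/-- `q` is an `n`-fold quadratic Pfister form.  In characteristic `2` this means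
`q ≅ ⟨⟨γ₁,…,γ_{n−1}, α]] = ⟨⟨γ₁,…,γ_{n−1}⟩⟩ ⊗ [1,α]`; in characteristic `≠ 2` it means
`q ≅ ⟨⟨γ₁,…,γ_n⟩⟩ = ⟨1,−γ₁⟩ ⊗ ⋯ ⊗ ⟨1,−γ_n⟩`. -/
def IsQPfister (n : ℕ) (q : QF F) : Prop :=
  if ringChar F = 2 then
    ∃ (l : List F) (α : F), UnitList l ∧ l.length + 1 = n ∧ (btensor l (binary α)).Equiv q
  else
    ∃ l : List F, UnitList l ∧ l.length = n ∧ (btensor l (unit F)).Equiv q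

/-- `φ` is a `k`-fold quadratic Pfister factor of `ψ`, i.e. `ψ ≅ B ⊗ φ` for some
bilinear Pfister form `B`. -/
def IsQPfisterFactor (k : ℕ) (φ ψ : QF F) : Prop :=
  IsQPfister k φ ∧ ∃ l : List F, UnitList l ∧ (btensor l φ).Equiv ψ

/-- A finite family of quadratic Pfister forms is (separably) `k`-linked if its members
share a common `k`-fold quadratic Pfister factor. -/
def SepLinked (k : ℕ) (ψs : List (QF F)) : Prop :=
  ∃ π : QF F, IsQPfister k π ∧
    ∀ ψ ∈ ψs, ∃ l : List F, UnitList l ∧ (btensor l π).Equiv ψ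

/-- A finite family of quadratic Pfister forms is inseparably `k`-linked if its members
share a common `k`-fold bilinear Pfister factor. -/
def InsepLinked (k : ℕ) (ψs : List (QF F)) : Prop :=
  ∃ l : List F, UnitList l ∧ l.length = k ∧
    ∀ ψ ∈ ψs, ∃ (n : ℕ) (π : QF F), IsQPfister n π ∧ (btensor l π).Equiv ψ

/-- `q` is the value of the two-form invariant `F²_k(ψ₁, ψ₂) = φ₁ ⊗ φ₂ ⊗ π`
for some presentation `ψ₁ ≅ φ₁ ⊗ π`, `ψ₂ ≅ φ₂ ⊗ π`. -/
def IsPairInv (k : ℕ) (ψ₁ ψ₂ q : QF F) : Prop :=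
  ∃ (π : QF F) (l₁ l₂ : List F), IsQPfister k π ∧ UnitList l₁ ∧ UnitList l₂ ∧
    (btensor l₁ π).Equiv ψ₁ ∧ (btensor l₂ π).Equiv ψ₂ ∧
    q.Equiv (btensor l₁ (btensor l₂ π))

/-- `IsInv k ψs q` : `q` is a value of the inductively defined invariant
`F^m_k(ψ₁,…,ψ_m)`, where `F¹_k(ψ) = ψ` and
`F^m_k(ψ₁,…,ψ_m) = F²_k(F^{m−1}_k(ψ₁,…,ψ_{m−1}), ψ_m)`. -/
inductive IsInv (k : ℕ) : List (QF F) → QF F → Prop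
  | single (ψ : QF F) : IsInv k [ψ] ψ
  | step {ψs : List (QF F)} {ψ q' q : QF F} :
      IsInv k ψs q' → IsPairInv k q' ψ q → IsInv k (ψs ++ [ψ]) q

end QF
namespace QF

variable {F : Type} [Field F]

/-- The (upper triangular) Gram-type matrix of a bundled quadratic form:
`q(∑ xᵢ eᵢ) = ∑ᵢ q(eᵢ) xᵢ² + ∑_{i<j} polar(eᵢ,eⱼ) xᵢ xⱼ`. -/
def matrixOf (q : QF F) : Matrix (Fin q.dim) (Fin q.dim) F := fun i j =>
  if i = j then q.form (Pi.single i 1)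
  else if i < j then polar q.form (Pi.single i 1) (Pi.single j 1)
  else 0

/-- Base change (extension of scalars) of a bundled quadratic form along a
ring homomorphism of fields. -/
def baseChange {E : Type} [Field E] (σ : F →+* E) (q : QF F) : QF E :=
  ⟨q.dim, (q.matrixOf.map σ).toQuadraticMap'⟩

/-- The homogeneous degree-2 polynomial cut out by a bundled quadratic form. -/
def toPoly (q : QF F) : MvPolynomial (Fin q.dim) F :=
  ∑ i, ∑ j, MvPolynomial.C (q.matrixOf i j) * (MvPolynomial.X i * MvPolynomial.X j)

/-- The affine coordinate ring of the quadric `q = 0`. -/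
def coordRing (q : QF F) : Type :=
  MvPolynomial (Fin q.dim) F ⧸ Ideal.span {q.toPoly}

instance (q : QF F) : CommRing q.coordRing := Ideal.Quotient.commRing _
instance (q : QF F) : Algebra F q.coordRing := Ideal.Quotient.algebra F

/-- The function field `F(q)` of the quadric `q = 0` (assuming the coordinate
ring is a domain). -/
def funField (q : QF F) : Type := FractionRing q.coordRing

instance (q : QF F) : CommRing q.funField := by unfold funField; infer_instance

noncomputable instance (q : QF F) [IsDomain q.coordRing] : Field q.funField := by
  unfold funField; infer_instance

/-- The canonical embedding `F → F(q)`. -/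
noncomputable def toFunField (q : QF F) : F →+* q.funField :=
  (algebraMap q.coordRing (FractionRing q.coordRing)).comp (algebraMap F q.coordRing)

/-- `⟨⟨γ₁,…,γ_m⟩⟩′ ⊗ q` : the tensor product with `q` of the pure part of the
bilinear Pfister form with slots `γ₁,…,γ_m`, so that
`⟨⟨l⟩⟩ ⊗ q ≅ q ⊥ (⟨⟨l⟩⟩′ ⊗ q)`. -/
def bpure : List F → QF F → QF F
  | [], _ => zero F
  | γ :: l, q => (bpure l q).sum ((-γ) • btensor l q)

end QF

namespace QF

variable {F : Type} [Field F]

section Isometry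

theorem Equiv.refl (q : QF F) : q.Equiv q := QuadraticMap.Equivalent.refl _

theorem Equiv.symm {a b : QF F} (h : a.Equiv b) : b.Equiv a := QuadraticMap.Equivalent.symm h

theorem Equiv.trans {a b c : QF F} (h : a.Equiv b) (h' : b.Equiv c) : a.Equiv c :=
  QuadraticMap.Equivalent.trans h h'

theorem smul_smul_eq (a b : F) (q : QF F) : a • b • q = (a * b) • q :=
  congrArg (QF.mk q.dim) (smul_smul a b q.form)

theorem smul_comm_eq (a b : F) (q : QF F) : a • b • q = b • a • q := by
  rw [smul_smul_eq, smul_smul_eq, mul_comm]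

/-- The bundled orthogonal sum is isometric to the orthogonal sum on the product space. -/
def sumIsometry (a b : QF F) : (a.sum b).form.IsometryEquiv (a.form.prod b.form) :=
  { finSplit F a.dim b.dim with map_app' := fun _ => rfl }

theorem sum_equivalent (a b : QF F) : (a.sum b).form.Equivalent (a.form.prod b.form) :=
  ⟨sumIsometry a b⟩

theorem Equiv.of_prod {a b c d : QF F}
    (h : (a.form.prod b.form).Equivalent (c.form.prod d.form)) :
    (a.sum b).Equiv (c.sum d) :=
  ((sum_equivalent a b).trans h).trans (sum_equivalent c d).symm

theorem Equiv.sum {a b c d : QF F} (h : a.Equiv c) (h' : b.Equiv d) :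
    (a.sum b).Equiv (c.sum d) :=
  .of_prod (QuadraticMap.Equivalent.prod h h')

theorem Equiv.smul {a b : QF F} (c : F) (h : a.Equiv b) : (c • a).Equiv (c • b) := by
  obtain ⟨e⟩ := h
  exact ⟨{ e.toLinearEquiv with map_app' := fun v => congrArg (c * ·) (e.map_app v) }⟩

theorem sum_comm_equiv (a b : QF F) : (a.sum b).Equiv (b.sum a) :=
  .of_prod ⟨QuadraticMap.IsometryEquiv.prodComm _ _⟩

theorem sum_sum_sum_comm_equiv (a b c d : QF F) :
    ((a.sum b).sum (c.sum d)).Equiv ((a.sum c).sum (b.sum d)) :=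
  .of_prod <| ((sum_equivalent a b).prod (sum_equivalent c d)).trans <|
    QuadraticMap.Equivalent.trans ⟨QuadraticMap.IsometryEquiv.prodProdProdComm _ _ _ _⟩
      ((sum_equivalent a c).prod (sum_equivalent b d)).symm

theorem sum_assoc_equiv (a b c : QF F) : ((a.sum b).sum c).Equiv (a.sum (b.sum c)) :=
  .of_prod <| ((sum_equivalent a b).prod (.refl c.form)).trans <|
    QuadraticMap.Equivalent.trans
      ⟨{ LinearEquiv.prodAssoc F (Fin a.dim → F) (Fin b.dim → F) (Fin c.dim → F) with
          map_app' := fun v => (add_assoc (a.form v.1.1) (b.form v.1.2) (c.form v.2)).symm }⟩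
      ((QuadraticMap.Equivalent.refl a.form).prod (sum_equivalent b c)).symm

theorem zero_sum_equiv (a : QF F) : ((zero F).sum a).Equiv a := by
  refine (sum_equivalent _ _).trans ⟨⟨?_, ?_⟩⟩
  · exact LinearEquiv.uniqueProd (M := Fin a.dim → F) (M₂ := Fin 0 → F)
  · intro v
    exact (zero_add (a.form v.2)).symm

theorem sum_zero_equiv (a : QF F) : (a.sum (zero F)).Equiv a :=
  (sum_comm_equiv _ _).trans (zero_sum_equiv a)

theorem smul_sum_equiv (c : F) (a b : QF F) :
    (c • a.sum b).Equiv ((c • a).sum (c • b)) :=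
  ⟨{ LinearEquiv.refl F (Fin (a.dim + b.dim) → F) with
      map_app' := fun v => (mul_add c (a.form (finSplit F a.dim b.dim v).1)
        (b.form (finSplit F a.dim b.dim v).2)).symm }⟩

theorem sq_smul_equiv {c : F} (hc : c ≠ 0) (q : QF F) : ((c * c) • q).Equiv q :=
  ⟨{ LinearEquiv.smulOfNeZero F (Fin q.dim → F) c hc with
      map_app' := fun v => QuadraticMap.map_smul q.form c v }⟩

/-- `⟨a, d⟩ ⊗ q ≅ ⟨a + d, (a + d)ad⟩ ⊗ q` whenever `a + d ≠ 0`. -/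
theorem smul_sum_smul_equiv (q : QF F) {a d : F} (h : a + d ≠ 0) :
    ((a • q).sum (d • q)).Equiv (((a + d) • q).sum (((a + d) * (a * d)) • q)) := by
  refine Equiv.symm (.of_prod ⟨⟨⟨⟨⟨fun p : (Fin q.dim → F) × (Fin q.dim → F) =>
      (p.1 - d • p.2, p.1 + a • p.2), ?_⟩, ?_⟩,
      fun p => ((a + d)⁻¹ • (a • p.1 + d • p.2), (a + d)⁻¹ • (p.2 - p.1)), ?_, ?_⟩, ?_⟩⟩)
  · intro p p'
    ext i <;> simp <;> ring
  · intro c p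
    ext i <;> simp <;> ring
  · intro p
    ext i <;> simp <;> field_simp <;> ring
  · intro p
    ext i <;> simp <;> field_simp <;> ring
  · rintro ⟨s, t⟩
    change a * q.form (s - d • t) + d * q.form (s + a • t) =
      (a + d) * q.form s + (a + d) * (a * d) * q.form t
    rw [sub_eq_add_neg, ← neg_smul, QuadraticMap.map_add q.form, QuadraticMap.map_add q.form,
      QuadraticMap.map_smul, QuadraticMap.map_smul, QuadraticMap.polar_smul_right,
      QuadraticMap.polar_smul_right]
    simp only [smul_eq_mul]
    ring

theorem Equiv.dim_eq {a b : QF F} (h : a.Equiv b) : a.dim = b.dim := by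
  obtain ⟨e⟩ := h
  simpa using e.toLinearEquiv.finrank_eq

end Isometry

section Tensor

theorem Equiv.twist (γ : F) {a b : QF F} (h : a.Equiv b) : (twist γ a).Equiv (twist γ b) :=
  h.sum (h.smul _)

theorem Equiv.btensor (l : List F) {a b : QF F} (h : a.Equiv b) :
    (btensor l a).Equiv (btensor l b) := by
  induction l with
  | nil => exact h
  | cons γ l ih => exact ih.twist γ

theorem btensor_append (l l' : List F) (q : QF F) :
    btensor (l ++ l') q = btensor l (btensor l' q) :=
  List.foldr_append

theorem twist_sum_equiv (γ : F) (a b : QF F) :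
    (twist γ (a.sum b)).Equiv ((twist γ a).sum (twist γ b)) :=
  ((Equiv.refl _).sum (smul_sum_equiv _ a b)).trans (sum_sum_sum_comm_equiv _ _ _ _)

theorem btensor_sum_equiv (l : List F) (a b : QF F) :
    (btensor l (a.sum b)).Equiv ((btensor l a).sum (btensor l b)) := by
  induction l with
  | nil => exact .refl _
  | cons γ l ih => exact (ih.twist γ).trans (twist_sum_equiv γ _ _)

theorem btensor_equiv_sum_bpure (l : List F) (q : QF F) :
    (btensor l q).Equiv (q.sum (bpure l q)) := by
  induction l with
  | nil => exact (sum_zero_equiv q).symm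
  | cons γ l ih => exact (ih.sum (.refl _)).trans (sum_assoc_equiv _ _ _)

theorem btensor_dim (l : List F) (q : QF F) : (btensor l q).dim = 2 ^ l.length * q.dim := by
  induction l with
  | nil => simp [btensor]
  | cons γ l ih =>
    change (btensor l q).dim + (btensor l q).dim = _
    rw [ih, List.length_cons, pow_succ]
    ring

theorem IsQPfister.dim_eq {n : ℕ} {q : QF F} (h : IsQPfister n q) : q.dim = 2 ^ n := by
  unfold IsQPfister at h
  split_ifs at h
  · obtain ⟨l, α, -, rfl, h⟩ := h
    rw [← h.dim_eq, btensor_dim, pow_succ]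
    rfl
  · obtain ⟨l, -, rfl, h⟩ := h
    rw [← h.dim_eq, btensor_dim]
    exact mul_one _

end Tensor

section Hyperbolic

theorem Isotropic.congr {a b : QF F} (ha : a.Isotropic) (h : a.Equiv b) : b.Isotropic := by
  obtain ⟨e⟩ := h
  obtain ⟨v, hv, hv0⟩ := ha
  exact ⟨e v, by rw [e.map_app, hv], fun h0 => hv0 (e.toLinearEquiv.map_eq_zero_iff.1 h0)⟩

theorem Hyperbolic.congr {a b : QF F} (ha : a.Hyperbolic) (h : a.Equiv b) : b.Hyperbolic :=
  ha.imp fun _ hm => h.symm.trans hm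

theorem hyps_sum_equiv (m n : ℕ) : ((hyps F m).sum (hyps F n)).Equiv (hyps F (m + n)) := by
  induction m with
  | zero =>
    rw [Nat.zero_add]
    exact zero_sum_equiv (hyps F n)
  | succ m ih =>
    rw [Nat.succ_add]
    exact (sum_assoc_equiv _ _ _).trans ((Equiv.refl _).sum ih)

theorem Hyperbolic.sum {a b : QF F} (ha : a.Hyperbolic) (hb : b.Hyperbolic) :
    (a.sum b).Hyperbolic := by
  obtain ⟨m, hm⟩ := ha
  obtain ⟨n, hn⟩ := hb
  exact ⟨m + n, (hm.sum hn).trans (hyps_sum_equiv m n)⟩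

theorem hyp_hyperbolic : (hyp F).Hyperbolic := ⟨1, (sum_zero_equiv _).symm⟩

theorem toQuadraticForm_fin_two (M : Matrix (Fin 2) (Fin 2) F) (v : Fin 2 → F) :
    M.toQuadraticForm' v =
      M 0 0 * (v 0 * v 0) + (M 0 1 + M 1 0) * (v 0 * v 1) + M 1 1 * (v 1 * v 1) := by
  simp [Matrix.toQuadraticForm', Matrix.toLinearMap₂'_apply, Fin.sum_univ_two]
  ring

theorem hyp_form (v : Fin 2 → F) : (hyp F).form v = v 0 * v 1 :=
  (toQuadraticForm_fin_two _ v).trans (by simp)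

theorem binary_form (α : F) (v : Fin 2 → F) :
    (binary α).form v = v 0 * v 0 + v 0 * v 1 + α * (v 1 * v 1) :=
  (toQuadraticForm_fin_two _ v).trans (by simp)

theorem unit_form (v : Fin 1 → F) : (unit F).form v = v 0 * v 0 := rfl

theorem smul_hyp_equiv {c : F} (hc : c ≠ 0) : (c • hyp F).Equiv (hyp F) := by
  refine ⟨⟨(⟨⟨⟨fun v => ![c * v 0, v 1], ?_⟩, ?_⟩,
    fun v => ![c⁻¹ * v 0, v 1], ?_, ?_⟩ : (Fin 2 → F) ≃ₗ[F] (Fin 2 → F)), ?_⟩⟩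
  · intro v w
    ext i; fin_cases i <;> simp <;> ring
  · intro r v
    ext i; fin_cases i <;> simp <;> ring
  · intro v
    ext i; fin_cases i <;> simp [hc]
  · intro v
    ext i; fin_cases i <;> simp [hc]
  · intro (v : Fin 2 → F)
    change (hyp F).form ![c * v 0, v 1] = c * (hyp F).form v
    rw [hyp_form, hyp_form]
    simp
    ring

theorem smul_hyps_equiv {c : F} (hc : c ≠ 0) (m : ℕ) : (c • hyps F m).Equiv (hyps F m) := by
  induction m with
  | zero =>
    exact ⟨{ LinearEquiv.refl F (Fin 0 → F) with map_app' := fun _ => (mul_zero c).symm }⟩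
  | succ m ih => exact (smul_sum_equiv _ _ _).trans ((smul_hyp_equiv hc).sum ih)

theorem Hyperbolic.smul_equiv {q : QF F} (hq : q.Hyperbolic) {c : F} (hc : c ≠ 0) :
    (c • q).Equiv q := by
  obtain ⟨m, hm⟩ := hq
  exact ((hm.smul c).trans (smul_hyps_equiv hc m)).trans hm.symm

theorem Hyperbolic.smul {q : QF F} (hq : q.Hyperbolic) {c : F} (hc : c ≠ 0) :
    (c • q).Hyperbolic :=
  hq.congr (hq.smul_equiv hc).symm

end Hyperbolic

section Round

/-- A form is round if it is isometric to its multiple by any nonzero value it represents. -/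
def Round (q : QF F) : Prop := ∀ v, q.form v ≠ 0 → (q.form v • q).Equiv q

/-- The properties of Pfister forms which are inherited by `⟨⟨γ⟩⟩ ⊗ q`: being round, being
hyperbolic as soon as they are isotropic, and `q ⊥ -q` being hyperbolic. -/
structure PfisterLike (q : QF F) : Prop where
  round : q.Round
  hyperbolic_of_isotropic : q.Isotropic → q.Hyperbolic
  sum_neg_hyperbolic : (q.sum ((-1 : F) • q)).Hyperbolic

theorem twist_form (γ : F) (q : QF F) (v : Fin (twist γ q).dim → F) :
    (twist γ q).form v = q.form (finSplit F q.dim q.dim v).1 +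
      -γ * q.form (finSplit F q.dim q.dim v).2 := rfl

theorem Round.twist {γ : F} (hγ : γ ≠ 0) {q : QF F} (hq : q.Round) : (twist γ q).Round := by
  intro v hv
  rw [twist_form] at hv ⊢
  set x := (finSplit F q.dim q.dim v).1
  set y := (finSplit F q.dim q.dim v).2
  refine (smul_sum_equiv _ _ _).trans ?_
  by_cases hy : q.form y = 0
  · rw [hy, mul_zero, add_zero] at hv ⊢
    refine (hq x hv).sum ?_
    rw [smul_comm_eq]
    exact (hq x hv).smul _
  by_cases hx : q.form x = 0
  · rw [hx, zero_add]
    refine ((Equiv.sum (c := (-γ) • q) (d := q) ?_ ?_)).trans (sum_comm_equiv _ _)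
    · rw [← smul_smul_eq]
      exact (hq y hy).smul _
    · rw [smul_comm_eq, ← smul_smul_eq, smul_smul_eq (-γ) (-γ)]
      exact ((hq y hy).smul _).trans (sq_smul_equiv (neg_ne_zero.2 hγ) q)
  · have h1 := smul_sum_smul_equiv q hv
    have h2 : ((q.form x • q).sum ((-γ * q.form y) • q)).Equiv (QF.twist γ q) := by
      refine (hq x hx).sum ?_
      rw [← smul_smul_eq]
      exact (hq y hy).smul _
    refine (Equiv.sum (.refl _) ?_).trans (h1.symm.trans h2)
    rw [show (q.form x + -γ * q.form y) * (q.form x * (-γ * q.form y)) =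
      ((q.form x + -γ * q.form y) * -γ) * (q.form x * q.form y) by ring,
      ← smul_smul_eq _ (q.form x * q.form y), smul_smul_eq, ← smul_smul_eq (q.form x)]
    exact ((((hq y hy).smul _).trans (hq x hx)).smul _).symm

theorem PfisterLike.twist {γ : F} (hγ : γ ≠ 0) {q : QF F} (hq : q.PfisterLike) :
    (twist γ q).PfisterLike where
  round := hq.round.twist hγ
  hyperbolic_of_isotropic := by
    rintro ⟨v, hv, hv0⟩
    by_cases hi : q.Isotropic
    · have h := hq.hyperbolic_of_isotropic hi
      exact h.sum (h.smul (neg_ne_zero.2 hγ))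
    have han : ∀ w, q.form w = 0 → w = 0 := fun w hw => by
      by_contra h
      exact hi ⟨w, hw, h⟩
    rw [twist_form] at hv
    have hy : q.form (finSplit F q.dim q.dim v).2 ≠ 0 := by
      intro hy
      rw [hy, mul_zero, add_zero] at hv
      exact hv0 ((finSplit F q.dim q.dim).map_eq_zero_iff.1 (Prod.ext (han _ hv) (han _ hy)))
    have hxy : q.form (finSplit F q.dim q.dim v).1 =
        γ * q.form (finSplit F q.dim q.dim v).2 := by linear_combination hv
    have hx : q.form (finSplit F q.dim q.dim v).1 ≠ 0 := hxy ▸ mul_ne_zero hγ hy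
    have h : (γ • q).Equiv q := by
      refine ((hq.round _ hy).symm.smul γ).trans ?_
      rw [smul_smul_eq, ← hxy]
      exact hq.round _ hx
    refine hq.sum_neg_hyperbolic.congr ((Equiv.refl q).sum ?_)
    rw [neg_eq_neg_one_mul γ, ← smul_smul_eq]
    exact h.symm.smul _
  sum_neg_hyperbolic := by
    refine (hq.sum_neg_hyperbolic.sum
      (hq.sum_neg_hyperbolic.smul (neg_ne_zero.2 hγ))).congr (Equiv.symm ?_)
    refine ((Equiv.refl _).sum (smul_sum_equiv _ _ _)).trans ?_
    refine (sum_sum_sum_comm_equiv _ _ _ _).trans ((Equiv.refl _).sum ?_)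
    rw [smul_comm_eq]
    exact (smul_sum_equiv _ _ _).symm

theorem PfisterLike.btensor {l : List F} (hl : UnitList l) {q : QF F} (hq : q.PfisterLike) :
    (btensor l q).PfisterLike := by
  induction l with
  | nil => exact hq
  | cons γ l ih =>
    exact (ih fun a ha => hl a (List.mem_cons_of_mem _ ha)).twist (hl γ List.mem_cons_self)

theorem unit_pfisterLike (h2 : (2 : F) ≠ 0) : (unit F).PfisterLike where
  round := by
    intro (v : Fin 1 → F) hv
    rw [unit_form] at hv ⊢
    exact sq_smul_equiv (left_ne_zero_of_mul hv) _
  hyperbolic_of_isotropic := by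
    rintro ⟨v, hv, hv0⟩
    change Fin 1 → F at v
    rw [unit_form, mul_self_eq_zero] at hv
    exact absurd (funext fun i : Fin 1 => by rw [Subsingleton.elim i 0, hv]; rfl) hv0
  sum_neg_hyperbolic := by
    refine hyp_hyperbolic.congr (Equiv.symm ((sum_equivalent _ _).trans ?_))
    refine ⟨⟨(⟨⟨⟨fun p => ![p.1 0 - p.2 0, p.1 0 + p.2 0], ?_⟩, ?_⟩,
      fun v => (fun _ => (v 0 + v 1) / 2, fun _ => (v 1 - v 0) / 2), ?_, ?_⟩ :
      ((Fin 1 → F) × (Fin 1 → F)) ≃ₗ[F] (Fin 2 → F)), ?_⟩⟩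
    · intro v w
      ext i; fin_cases i <;> simp <;> ring
    · intro r v
      ext i; fin_cases i <;> simp <;> ring
    · intro v
      ext i <;> rw [Subsingleton.elim i 0] <;> simp <;> field_simp <;> ring
    · intro v
      ext i; fin_cases i <;> simp <;> field_simp <;> ring
    · rintro ⟨v, w⟩
      change Fin 1 → F at v w
      change (hyp F).form ![v 0 - w 0, v 0 + w 0] = v 0 * v 0 + -1 * (w 0 * w 0)
      rw [hyp_form]
      simp
      ring

theorem binary_round (α : F) : (binary α).Round := by
  intro (v : Fin 2 → F) hv
  rw [binary_form] at hv ⊢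
  set N := v 0 * v 0 + v 0 * v 1 + α * (v 1 * v 1) with hN
  refine ⟨⟨(⟨⟨⟨fun w => ![v 0 * w 0 - α * (v 1 * w 1),
      v 0 * w 1 + v 1 * w 0 + v 1 * w 1], ?_⟩, ?_⟩,
    fun w => ![N⁻¹ * ((v 0 + v 1) * w 0 + α * (v 1 * w 1)),
      N⁻¹ * (v 0 * w 1 - v 1 * w 0)], ?_, ?_⟩ : (Fin 2 → F) ≃ₗ[F] (Fin 2 → F)), ?_⟩⟩
  · intro w w'
    ext i; fin_cases i <;> simp <;> ring
  · intro r w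
    ext i; fin_cases i <;> simp <;> ring
  · intro w
    ext i; fin_cases i <;> simp <;> rw [inv_mul_eq_iff_eq_mul₀ hv, hN] <;> ring
  · intro w
    ext i; fin_cases i <;> simp <;> field_simp <;> rw [hN] <;> ring
  · intro (w : Fin 2 → F)
    change (binary α).form ![_, _] = N * (binary α).form w
    rw [binary_form, binary_form, hN]
    simp
    ring

theorem binary_hyperbolic_of_isotropic (h2 : (2 : F) = 0) (α : F) (h : (binary α).Isotropic) :
    (binary α).Hyperbolic := by
  obtain ⟨v, hv, hv0⟩ := h
  change Fin 2 → F at v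
  rw [binary_form] at hv
  have h1 : v 1 ≠ 0 := by
    intro h1
    rw [h1] at hv
    have h0 : v 0 = 0 := by simpa using hv
    refine hv0 (funext fun i : Fin 2 => ?_)
    fin_cases i
    · exact h0
    · exact h1
  obtain ⟨x, hx⟩ : ∃ x, α = -(x * x) - x := by
    refine ⟨v 0 / v 1, ?_⟩
    field_simp
    linear_combination hv
  refine hyp_hyperbolic.congr (Equiv.symm ⟨⟨(⟨⟨⟨fun w =>
      ![w 0 - x * w 1, w 0 + (1 + x) * w 1], ?_⟩, ?_⟩,
    fun w => ![w 0 + x * (w 1 - w 0), w 1 - w 0], ?_, ?_⟩ :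
      (Fin 2 → F) ≃ₗ[F] (Fin 2 → F)), ?_⟩⟩)
  · intro w w'
    ext i; fin_cases i <;> simp <;> ring
  · intro r w
    ext i; fin_cases i <;> simp <;> ring
  · intro w
    ext i; fin_cases i <;> simp
    · linear_combination (x * x * w 1) * h2
    · linear_combination (x * w 1) * h2
  · intro w
    ext i; fin_cases i <;> simp
    linear_combination (x * (w 1 - w 0)) * h2
  · intro (w : Fin 2 → F)
    change (hyp F).form ![_, _] = (binary α).form w
    rw [hyp_form, binary_form, hx]
    simp
    ring

theorem binary_sum_neg_hyperbolic (h2 : (2 : F) = 0) (α : F) :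
    ((binary α).sum ((-1 : F) • binary α)).Hyperbolic := by
  refine (hyp_hyperbolic.sum hyp_hyperbolic).congr (Equiv.symm (.of_prod
    ⟨⟨(⟨⟨⟨fun p => (![p.1 0 - p.2 0, p.1 0 - p.2 0 + p.1 1],
        ![p.1 1 - p.2 1, α * (p.1 1 - p.2 1) + p.2 0]), ?_⟩, ?_⟩,
      fun p => (![p.1 0 + (p.2 1 - α * p.2 0), p.1 1 - p.1 0],
        ![p.2 1 - α * p.2 0, p.1 1 - p.1 0 - p.2 0]), ?_, ?_⟩ :
      ((Fin 2 → F) × (Fin 2 → F)) ≃ₗ[F] ((Fin 2 → F) × (Fin 2 → F))), ?_⟩⟩))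
  · intro w w'
    ext i <;> fin_cases i <;> simp <;> ring
  · intro r w
    ext i <;> fin_cases i <;> simp <;> ring
  · intro w
    ext i <;> fin_cases i <;> simp
  · intro w
    ext i <;> fin_cases i <;> simp
  · rintro ⟨v, w⟩
    change Fin 2 → F at v w
    change (hyp F).form ![_, _] + (hyp F).form ![_, _] =
      (binary α).form v + -1 * (binary α).form w
    rw [hyp_form, hyp_form, binary_form, binary_form]
    simp
    linear_combination (w 0 * w 0 + α * (w 1 * w 1) - v 0 * w 0 - α * (v 1 * w 1)) * h2

theorem binary_pfisterLike (h2 : (2 : F) = 0) (α : F) : (binary α).PfisterLike :=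
  ⟨binary_round α, binary_hyperbolic_of_isotropic h2 α, binary_sum_neg_hyperbolic h2 α⟩

/-- An isotropic form `B ⊗ π`, with `π` a quadratic Pfister form and `B` a bilinear Pfister form,
is hyperbolic. -/
theorem IsQPfister.btensor_hyperbolic_of_isotropic {n : ℕ} {π : QF F} (hπ : IsQPfister n π)
    {l : List F} (hl : UnitList l) (h : (btensor l π).Isotropic) : (btensor l π).Hyperbolic := by
  obtain ⟨ρ, hρ, he⟩ : ∃ ρ : QF F, ρ.PfisterLike ∧ ρ.Equiv π := by
    unfold IsQPfister at hπ
    split_ifs at hπ with hc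
    · obtain ⟨l, α, hl, -, he⟩ := hπ
      have : CharP F 2 := ringChar.of_eq hc
      exact ⟨_, (binary_pfisterLike CharTwo.two_eq_zero α).btensor hl, he⟩
    · obtain ⟨l, hl, -, he⟩ := hπ
      exact ⟨_, (unit_pfisterLike (Ring.two_ne_zero hc)).btensor hl, he⟩
  exact ((hρ.btensor hl).hyperbolic_of_isotropic (h.congr (he.btensor l).symm)).congr
    (he.btensor l)

end Round

section Linked

/-- A form `q` with `q ⊥ s ≅ π ⊥ r` and `dim π < dim q` has a nonzero vector on which it takes a
value attained by `r`. -/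
theorem exists_form_eq_of_dim_lt {q s π r : QF F} (h : (q.sum s).Equiv (π.sum r))
    (hdim : π.dim < q.dim) : ∃ w ≠ 0, ∃ u, r.form u = q.form w := by
  obtain ⟨e⟩ := ((sum_equivalent q s).symm.trans h).trans (sum_equivalent π r)
  let g : (Fin q.dim → F) →ₗ[F] (Fin π.dim → F) :=
    LinearMap.fst F _ _ ∘ₗ e.toLinearEquiv.toLinearMap ∘ₗ LinearMap.inl F _ _
  obtain ⟨w, hw, hw0⟩ := (LinearMap.ker g).ne_bot_iff.1
    (LinearMap.ker_ne_bot_of_finrank_lt (f := g) (by simpa using hdim))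
  refine ⟨w, hw0, (e (w, 0)).2, ?_⟩
  have hm := e.map_app (w, 0)
  have hg : (e (w, 0)).1 = 0 := hw
  rw [QuadraticMap.prod_apply, QuadraticMap.prod_apply, hg, QuadraticMap.map_zero, zero_add,
    QuadraticMap.map_zero, add_zero] at hm
  exact hm

theorem Isotropic.sum_left {a : QF F} (ha : a.Isotropic) (b : QF F) : (a.sum b).Isotropic := by
  obtain ⟨v, hv, hv0⟩ := ha
  have h : (a.form.prod b.form) (v, 0) = 0 := by simp [hv]
  refine ⟨(sumIsometry a b).symm (v, 0), by rw [QuadraticMap.IsometryEquiv.map_app, h], ?_⟩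
  intro h0
  exact hv0 (congrArg Prod.fst ((sumIsometry a b).symm.toLinearEquiv.map_eq_zero_iff.1 h0))

theorem isotropic_sum_of_dim_lt (hsq : IsSquare (-1 : F)) {q s s' π r : QF F}
    (h : (q.sum s).Equiv (π.sum r)) (hdim : π.dim < q.dim) :
    ((q.sum s').sum r).Isotropic := by
  obtain ⟨w, hw0, u, hu⟩ := exists_form_eq_of_dim_lt h hdim
  obtain ⟨i, hi⟩ := hsq
  have hqr : (q.sum r).Isotropic := by
    have h0 : (q.form.prod r.form) (w, i • u) = 0 := by
      rw [QuadraticMap.prod_apply, QuadraticMap.map_smul, ← hi, hu]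
      simp
    refine ⟨(sumIsometry q r).symm (w, i • u), by rw [QuadraticMap.IsometryEquiv.map_app, h0], ?_⟩
    intro h0
    exact hw0 (congrArg Prod.fst ((sumIsometry q r).symm.toLinearEquiv.map_eq_zero_iff.1 h0))
  exact (hqr.sum_left s').congr <| (sum_assoc_equiv _ _ _).trans <|
    ((Equiv.refl q).sum (sum_comm_equiv _ _)).trans (sum_assoc_equiv _ _ _).symm

end Linked

end QF

/-- Let `F` be a field of any characteristic in which `−1` is a square.
If `ψ₁` and `ψ₂` are quadratic Pfister forms over `F` that are `(k+1)`-linked, then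
their `k`-invariant `F_k(ψ₁, ψ₂)` is hyperbolic. -/
theorem kplusone_linked_implies_invariant_hyperbolic
    (F : Type) [Field F] (hsq : IsSquare (-1 : F)) (k : ℕ)
    (ψ₁ ψ₂ : QF F)
    (hlink : QF.SepLinked (k + 1) [ψ₁, ψ₂]) :
    ∀ q, QF.IsPairInv k ψ₁ ψ₂ q → q.Hyperbolic := by
  rintro q ⟨π, l₁, l₂, hπ, hl₁, hl₂, h₁, h₂, hq⟩
  obtain ⟨ρ, hρ, hlink⟩ := hlink
  obtain ⟨m₁, -, hm₁⟩ := hlink ψ₁ (by simp)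
  obtain ⟨m₂, -, hm₂⟩ := hlink ψ₂ (by simp)
  have hdim : π.dim < ρ.dim := by
    rw [hπ.dim_eq, hρ.dim_eq]
    exact Nat.pow_lt_pow_right one_lt_two k.lt_succ_self
  have hψ₁ : (ρ.sum (QF.bpure m₁ ρ)).Equiv (QF.btensor l₁ π) :=
    ((QF.btensor_equiv_sum_bpure m₁ ρ).symm.trans hm₁).trans h₁.symm
  have hψ₂ : (ρ.sum (QF.bpure m₂ ρ)).Equiv (π.sum (QF.bpure l₂ π)) :=
    ((QF.btensor_equiv_sum_bpure m₂ ρ).symm.trans hm₂).trans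
      (h₂.symm.trans (QF.btensor_equiv_sum_bpure l₂ π))
  have hiso : ((ρ.sum (QF.bpure m₁ ρ)).sum (QF.bpure l₂ π)).Isotropic :=
    QF.isotropic_sum_of_dim_lt hsq hψ₂ hdim
  have hdecomp : (QF.btensor l₁ (QF.btensor l₂ π)).Equiv
      (((ρ.sum (QF.bpure m₁ ρ)).sum (QF.bpure l₂ π)).sum
        (QF.bpure l₁ (QF.bpure l₂ π))) :=
    (((QF.btensor_equiv_sum_bpure l₂ π).btensor l₁).trans
      (QF.btensor_sum_equiv l₁ _ _)).trans
      ((hψ₁.symm.sum (QF.btensor_equiv_sum_bpure l₁ _)).trans (QF.sum_assoc_equiv _ _ _).symm)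
  have hunit : QF.UnitList (l₁ ++ l₂) := fun γ hγ =>
    (List.mem_append.1 hγ).elim (hl₁ γ) (hl₂ γ)
  have hhyp : (QF.btensor (l₁ ++ l₂) π).Hyperbolic := by
    refine hπ.btensor_hyperbolic_of_isotropic hunit ?_
    rw [QF.btensor_append]
    exact (hiso.sum_left _).congr hdecomp.symm
  rw [QF.btensor_append] at hhyp
  exact hhyp.congr hq.symm
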